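/- arXiv:1911.09806 — 13 statements merged into one kernel-verified Lean document; each statement's English description precedes it below -/
import Mathlib

section
/- Consider a congestion game with n players in which every resource e has cost function ℓ_e(x)=α_e·x²+β_e·x+γ_e with α_e,β_e,γ_e ≥ 0, and a constant (congestion-independent) toll τ_e(x)=3·α_e. Then for every pure Nash equilibrium a and every feasible allocation a′ it holds that SC(a) ≤ (16/3)·SC(a′). -/
/-- Number of players using resource `e` in allocation `a`. -/
def cgLoad {n : ℕ} {E : Type*} [DecidableEq E] (a : Fin n → Finset E) (e : E) : ℕ :=
  (Finset.univ.filter fun i => e ∈ a i).card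

/-- Social cost `SC(a) = Σ_e |a|_e · ℓ_e(|a|_e)`. -/
def cgSocialCost {n : ℕ} {E : Type*} [DecidableEq E] [Fintype E] (cost : E → ℕ → ℝ)
    (a : Fin n → Finset E) : ℝ :=
  ∑ e, (cgLoad a e : ℝ) * cost e (cgLoad a e)

/-- Cost of player `i`: `C_i(a) = Σ_{e ∈ a_i} [ℓ_e(|a|_e) + τ_e(|a|_e)]`. -/
def cgPlayerCost {n : ℕ} {E : Type*} [DecidableEq E] (cost toll : E → ℕ → ℝ)
    (a : Fin n → Finset E) (i : Fin n) : ℝ :=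
  ∑ e ∈ a i, (cost e (cgLoad a e) + toll e (cgLoad a e))

/-- `a` is a pure Nash equilibrium of the congestion game with action sets `A`,
resource costs `cost` and tolls `toll`. -/
def cgIsNash {n : ℕ} {E : Type*} [DecidableEq E] (A : Fin n → Set (Finset E))
    (cost toll : E → ℕ → ℝ) (a : Fin n → Finset E) : Prop :=
  ∀ i : Fin n, ∀ b ∈ A i,
    cgPlayerCost cost toll a i ≤ cgPlayerCost cost toll (Function.update a i b) i

/-- The cubic smoothness inequality behind the bound; it is tight at `(2, 1)` and `(6, 2)`. -/
lemma cubic_smoothness (x y : ℕ) :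
    0 ≤ (x : ℝ) ^ 3 + 12 * x - 4 * y * ((x : ℝ) ^ 2 + 2 * x + 4) + 16 * (y : ℝ) ^ 3 := by
  have hx : (0 : ℝ) ≤ x := Nat.cast_nonneg x
  obtain rfl | rfl | rfl | hy : y = 0 ∨ y = 1 ∨ y = 2 ∨ 3 ≤ y := by omega
  · simp only [Nat.cast_zero]
    nlinarith [pow_nonneg hx 3]
  · simp only [Nat.cast_one]
    nlinarith [mul_nonneg hx (sq_nonneg ((x : ℝ) - 2))]
  · obtain h | h : x ≤ 5 ∨ 6 ≤ x := by omega
    · interval_cases x <;> norm_num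
    · have h6 : (6 : ℝ) ≤ x := by exact_mod_cast h
      have hq : (0 : ℝ) ≤ (x : ℝ) ^ 2 - 2 * x - 16 := by nlinarith
      push_cast
      nlinarith [mul_nonneg (sub_nonneg.2 h6) hq]
  · have hy3 : (3 : ℝ) ≤ y := by exact_mod_cast hy
    generalize (x : ℝ) = x at *
    generalize (y : ℝ) = y at *
    have hdecomp : x ^ 3 + 12 * x - 4 * y * (x ^ 2 + 2 * x + 4) + 16 * y ^ 3
        = x * (x - 2 * y) ^ 2 + 4 * (y - 1) * (2 * y * (y - 1) - (x - 2 * y) * (y + 3)) := by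
      ring
    rw [hdecomp]
    obtain h | h := le_total x (2 * y)
    · have h1 : 0 ≤ (2 * y - x) * (y + 3) := mul_nonneg (by linarith) (by linarith)
      have h2 : 0 ≤ y * (y - 1) := mul_nonneg (by linarith) (by linarith)
      have h3 : 0 ≤ 4 * (y - 1) * (2 * y * (y - 1) - (x - 2 * y) * (y + 3)) :=
        mul_nonneg (by linarith) (by linarith)
      have h4 : 0 ≤ x * (x - 2 * y) ^ 2 := by positivity
      linarith
    · obtain ⟨s, rfl⟩ : ∃ s, x = 2 * y + s := ⟨x - 2 * y, by ring⟩
      have hs : 0 ≤ s := by linarith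
      have h1 : 0 ≤ s ^ 3 := by positivity
      have h2 : 0 ≤ 2 * y * (s - 2 * (y - 1)) ^ 2 := by
        have : 0 ≤ y := by linarith
        positivity
      have h3 : 0 ≤ 4 * ((y - 1) * s) * (y - 3) :=
        mul_nonneg (mul_nonneg (by norm_num) (mul_nonneg (by linarith) hs)) (by linarith)
      linear_combination h1 + h2 + h3

/-- Summing over the players' resources counts each resource with its load. -/
lemma sum_players_eq_sum_load {n : ℕ} {E : Type*} [DecidableEq E] [Fintype E]
    (b : Fin n → Finset E) (f : E → ℝ) :
    ∑ i, ∑ e ∈ b i, f e = ∑ e, (cgLoad b e : ℝ) * f e := by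
  have h : ∀ i, ∑ e ∈ b i, f e = ∑ e, if e ∈ b i then f e else 0 := fun i => by
    rw [← Finset.sum_filter, Finset.filter_mem_eq_inter, Finset.univ_inter]
  simp_rw [h]
  rw [Finset.sum_comm]
  refine Finset.sum_congr rfl fun e _ => ?_
  rw [← Finset.sum_filter, Finset.sum_const, nsmul_eq_mul, cgLoad]

/-- A unilateral deviation raises the load of a resource by at most one. -/
lemma cgLoad_update_le {n : ℕ} {E : Type*} [DecidableEq E] (a : Fin n → Finset E)
    (i : Fin n) (b : Finset E) (e : E) :
    cgLoad (Function.update a i b) e ≤ cgLoad a e + 1 := by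
  unfold cgLoad
  refine (Finset.card_le_card fun j hj => ?_).trans (Finset.card_insert_le i _)
  by_cases hji : j = i
  · simp [hji]
  · simpa [hji] using hj

/-- At a Nash equilibrium, if the total cost of each resource is monotone in its load, the players'
total cost is at most what they would pay for `a'` with every load raised by one. -/
lemma sum_load_le_of_cgIsNash {n : ℕ} {E : Type*} [DecidableEq E] [Fintype E]
    {A : Fin n → Set (Finset E)} {cost toll : E → ℕ → ℝ} {a a' : Fin n → Finset E}
    (hmono : ∀ e, Monotone fun x => cost e x + toll e x)
    (ha' : ∀ i, a' i ∈ A i) (hNash : cgIsNash A cost toll a) :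
    ∑ e, (cgLoad a e : ℝ) * (cost e (cgLoad a e) + toll e (cgLoad a e)) ≤
      ∑ e, (cgLoad a' e : ℝ) * (cost e (cgLoad a e + 1) + toll e (cgLoad a e + 1)) := by
  rw [← sum_players_eq_sum_load a, ← sum_players_eq_sum_load a']
  refine Finset.sum_le_sum fun i _ => (hNash i (a' i) (ha' i)).trans ?_
  rw [cgPlayerCost, Function.update_self]
  exact Finset.sum_le_sum fun e _ => hmono e (cgLoad_update_le a i (a' i) e)

/-- with quadratic resource costs `ℓ_e(x) = α_e x² + β_e x + γ_e`
(nonnegative coefficients) and the constant toll `τ_e(x) = 3 α_e`, every pure Nash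
equilibrium `a` satisfies `SC(a) ≤ (16/3)·SC(a')` for every feasible allocation `a'`. -/
theorem constant_toll_quadratic_poa
    {n : ℕ} {E : Type*} [DecidableEq E] [Fintype E]
    (A : Fin n → Set (Finset E)) (α β γ : E → ℝ)
    (hα : ∀ e, 0 ≤ α e) (hβ : ∀ e, 0 ≤ β e) (hγ : ∀ e, 0 ≤ γ e)
    (cost toll : E → ℕ → ℝ)
    (hcost : ∀ e (x : ℕ), cost e x = α e * (x : ℝ) ^ 2 + β e * (x : ℝ) + γ e)
    (htoll : ∀ e (x : ℕ), toll e x = 3 * α e)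
    (a a' : Fin n → Finset E)
    (ha : ∀ i, a i ∈ A i) (ha' : ∀ i, a' i ∈ A i)
    (hNash : cgIsNash A cost toll a) :
    cgSocialCost cost a ≤ (16 / 3) * cgSocialCost cost a' := by
  have hmono : ∀ e, Monotone fun x => cost e x + toll e x := fun e x y hxy => by
    have h := hα e
    have h' := hβ e
    simp only [hcost, htoll]
    gcongr
  have hsum := sum_load_le_of_cgIsNash hmono ha' hNash
  have hsmooth : ∀ e, (cgLoad a e : ℝ) * cost e (cgLoad a e)
      ≤ 16 / 3 * ((cgLoad a' e : ℝ) * cost e (cgLoad a' e))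
        + 4 / 3 * ((cgLoad a e : ℝ) * (cost e (cgLoad a e) + toll e (cgLoad a e))
          - (cgLoad a' e : ℝ) * (cost e (cgLoad a e + 1) + toll e (cgLoad a e + 1))) := by
    intro e
    simp only [hcost, htoll]
    generalize cgLoad a e = x
    generalize cgLoad a' e = y
    have hx : (0 : ℝ) ≤ x := Nat.cast_nonneg x
    have hy : (0 : ℝ) ≤ y := Nat.cast_nonneg y
    have hyy : (y : ℝ) ≤ (y : ℝ) ^ 2 := by exact_mod_cast Nat.le_self_pow two_ne_zero y
    have h1 := mul_nonneg (hα e) (cubic_smoothness x y)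
    have h2 : 0 ≤ β e * ((x : ℝ) ^ 2 - 4 * y * (x + 1) + 16 * (y : ℝ) ^ 2) :=
      mul_nonneg (hβ e) (by nlinarith [sq_nonneg ((x : ℝ) - 2 * y)])
    have h3 : 0 ≤ γ e * ((x : ℝ) + 12 * y) := mul_nonneg (hγ e) (by positivity)
    push_cast
    linear_combination (1 / 3) * h1 + (1 / 3) * h2 + (1 / 3) * h3
  have htotal := Finset.sum_le_sum fun e (_ : e ∈ Finset.univ) => hsmooth e
  rw [Finset.sum_add_distrib, ← Finset.mul_sum, ← Finset.mul_sum,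
    Finset.sum_sub_distrib] at htotal
  unfold cgSocialCost
  linarith
end

section
/- For every real number τ ≥ 0 there exists a congestion game in which every resource e has cost function ℓ_e(x)=α_e·x² with α_e ≥ 0 and constant toll τ_e(x)=τ·α_e, together with a pure Nash equilibrium a and a feasible allocation a′, such that SC(a) ≥ (16/3)·SC(a′). -/
/-- Shared resources are those below `n`, arranged in a cycle; player `i` uses the `p` shared
resources starting at the `i`-th one. -/
def cyclicNash (n p : ℕ) (i : Fin n) : Finset (Fin (n + n)) :=
  Finset.univ.filter fun e => e.val < n ∧ (e.val + n - i.val) % n < p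

/-- Player `i` uses the shared resources outside `cyclicNash n p i`, together with the private
resource `n + i`. -/
def cyclicOpt (n p : ℕ) (i : Fin n) : Finset (Fin (n + n)) :=
  Finset.univ.filter fun e =>
    (e.val < n ∧ p ≤ (e.val + n - i.val) % n) ∨ e.val = n + i.val

theorem cgPlayerCost_eq_of_load {n m k c d x y : ℕ} {cost toll : Fin m → ℕ → ℝ} {α : Fin m → ℝ}
    {τ t : ℝ} (hα : ∀ e, α e = if e.val < k then 1 else t)
    (hcost : ∀ e (x : ℕ), cost e x = α e * (x : ℝ) ^ 2) (htoll : ∀ e (x : ℕ), toll e x = τ * α e)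
    (b : Fin n → Finset (Fin m)) (i : Fin n)
    (hload : ∀ e ∈ b i, cgLoad b e = if e.val < k then x else y)
    (hc : ((b i).filter fun e => e.val < k).card = c)
    (hd : ((b i).filter fun e => ¬ e.val < k).card = d) :
    cgPlayerCost cost toll b i = c * ((x : ℝ) ^ 2 + τ) + d * (t * ((y : ℝ) ^ 2 + τ)) := by
  have h : ∀ e ∈ b i, cost e (cgLoad b e) + toll e (cgLoad b e) =
      if e.val < k then (x : ℝ) ^ 2 + τ else t * ((y : ℝ) ^ 2 + τ) := by
    intro e he
    rw [hcost, htoll, hload e he, hα]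
    split_ifs <;> ring
  rw [cgPlayerCost, Finset.sum_congr rfl h, Finset.sum_ite, Finset.sum_const, Finset.sum_const,
    hc, hd, nsmul_eq_mul, nsmul_eq_mul]

theorem cgSocialCost_eq_of_load {n k x y : ℕ} {cost : Fin (k + k) → ℕ → ℝ} {α : Fin (k + k) → ℝ}
    {t : ℝ} (hα : ∀ e, α e = if e.val < k then 1 else t)
    (hcost : ∀ e (x : ℕ), cost e x = α e * (x : ℝ) ^ 2) (b : Fin n → Finset (Fin (k + k)))
    (hload : ∀ e, cgLoad b e = if e.val < k then x else y) :
    cgSocialCost cost b = k * ((x : ℝ) ^ 3 + t * (y : ℝ) ^ 3) := by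
  simp only [cgSocialCost, hcost, hload, hα, Fin.sum_univ_add, Fin.val_castAdd, Fin.val_natAdd,
    Fin.is_lt, if_true, Nat.not_lt.mpr (Nat.le_add_right _ _), if_false, Finset.sum_const,
    Finset.card_univ, Fintype.card_fin, nsmul_eq_mul]
  ring

/-- The cyclic game in which every shared resource has load `p` in equilibrium and `q` in the
alternative allocation, and the private resources have coefficient `t`. -/
theorem exists_cyclic_game {n p q : ℕ} {τ t r : ℝ} (ht : 0 ≤ t) (hn : 0 < n) (hq : 0 < q)
    (hN : ∀ e, cgLoad (cyclicNash n p) e = if e.val < n then p else 0)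
    (hO : ∀ e, cgLoad (cyclicOpt n p) e = if e.val < n then q else 1)
    (hU : ∀ i, ∀ e ∈ cyclicOpt n p i,
      cgLoad (Function.update (cyclicNash n p) i (cyclicOpt n p i)) e =
        if e.val < n then p + 1 else 1)
    (hNs : ∀ i, ((cyclicNash n p i).filter fun e => e.val < n).card = p)
    (hNp : ∀ i, ((cyclicNash n p i).filter fun e => ¬ e.val < n).card = 0)
    (hOs : ∀ i, ((cyclicOpt n p i).filter fun e => e.val < n).card = q)
    (hOp : ∀ i, ((cyclicOpt n p i).filter fun e => ¬ e.val < n).card = 1)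
    (hdev : p * ((p : ℝ) ^ 2 + τ) ≤ q * (((p : ℝ) + 1) ^ 2 + τ) + t * (1 + τ))
    (hratio : r * ((q : ℝ) ^ 3 + t) ≤ (p : ℝ) ^ 3) :
    ∃ (n m : ℕ) (A : Fin n → Set (Finset (Fin m))) (α : Fin m → ℝ)
      (cost toll : Fin m → ℕ → ℝ) (a a' : Fin n → Finset (Fin m)),
      (∀ e, 0 ≤ α e) ∧
      (∀ e (x : ℕ), cost e x = α e * (x : ℝ) ^ 2) ∧
      (∀ e (x : ℕ), toll e x = τ * α e) ∧
      (∀ i, a i ∈ A i) ∧ (∀ i, a' i ∈ A i) ∧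
      cgIsNash A cost toll a ∧
      0 < cgSocialCost cost a' ∧
      r * cgSocialCost cost a' ≤ cgSocialCost cost a := by
  have hn' : (0 : ℝ) < n := by exact_mod_cast hn
  have hq' : (0 : ℝ) < q := by exact_mod_cast hq
  refine ⟨n, n + n, fun i => {cyclicNash n p i, cyclicOpt n p i},
    fun e => if e.val < n then 1 else t,
    fun e x => (if e.val < n then 1 else t) * (x : ℝ) ^ 2,
    fun e _ => τ * (if e.val < n then 1 else t),
    cyclicNash n p, cyclicOpt n p, ?_, fun _ _ => rfl, fun _ _ => rfl,
    fun i => Or.inl rfl, fun i => Or.inr rfl, ?_, ?_, ?_⟩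
  · intro e
    dsimp only
    split_ifs <;> positivity
  · rintro i b (rfl | rfl)
    · rw [Function.update_eq_self]
    · rw [cgPlayerCost_eq_of_load (fun _ => rfl) (fun _ _ => rfl) (fun _ _ => rfl)
          (cyclicNash n p) i (fun e _ => hN e) (hNs i) (hNp i),
        cgPlayerCost_eq_of_load (c := q) (d := 1) (fun _ => rfl) (fun _ _ => rfl) (fun _ _ => rfl)
          (Function.update (cyclicNash n p) i (cyclicOpt n p i)) i
          (by rw [Function.update_self]; exact hU i)
          (by rw [Function.update_self]; exact hOs i)
          (by rw [Function.update_self]; exact hOp i)]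
      push_cast
      linarith
  · rw [cgSocialCost_eq_of_load (fun _ => rfl) (fun _ _ => rfl) _ hO]
    push_cast
    positivity
  · rw [cgSocialCost_eq_of_load (fun _ => rfl) (fun _ _ => rfl) _ hO,
      cgSocialCost_eq_of_load (fun _ => rfl) (fun _ _ => rfl) _ hN]
    push_cast
    nlinarith [mul_le_mul_of_nonneg_left hratio hn'.le]

/-- for every `τ ≥ 0` there is a congestion game with resource costs
`ℓ_e(x) = α_e x²` (`α_e ≥ 0`) and constant tolls `τ_e(x) = τ·α_e`, a pure Nash
equilibrium `a` and a feasible allocation `a'` with `SC(a) ≥ (16/3)·SC(a')`. -/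
theorem constant_toll_quadratic_lower_bound (τ : ℝ) (hτ : 0 ≤ τ) :
    ∃ (n m : ℕ) (A : Fin n → Set (Finset (Fin m))) (α : Fin m → ℝ)
      (cost toll : Fin m → ℕ → ℝ) (a a' : Fin n → Finset (Fin m)),
      (∀ e, 0 ≤ α e) ∧
      (∀ e (x : ℕ), cost e x = α e * (x : ℝ) ^ 2) ∧
      (∀ e (x : ℕ), toll e x = τ * α e) ∧
      (∀ i, a i ∈ A i) ∧ (∀ i, a' i ∈ A i) ∧
      cgIsNash A cost toll a ∧
      0 < cgSocialCost cost a' ∧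
      (16 / 3) * cgSocialCost cost a' ≤ cgSocialCost cost a := by
  have h1 : 0 < 1 + τ := by linarith
  rcases le_total τ 3 with h3 | h3
  · refine exists_cyclic_game (n := 3) (p := 2) (q := 1) (t := max 0 ((τ - 1) / (1 + τ)))
      (le_max_left _ _) (by norm_num) (by norm_num) (by decide) (by decide) (by decide)
      (by decide) (by decide) (by decide) (by decide) ?_ ?_
    · have h := mul_le_mul_of_nonneg_right (le_max_right 0 ((τ - 1) / (1 + τ))) h1.le
      rw [div_mul_cancel₀ _ h1.ne'] at h
      push_cast
      linarith
    · have h : max 0 ((τ - 1) / (1 + τ)) ≤ 1 / 2 :=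
        max_le (by norm_num) (by rw [div_le_iff₀ h1]; linarith)
      push_cast
      linarith
  · refine exists_cyclic_game (n := 8) (p := 6) (q := 2) (t := (118 + 4 * τ) / (1 + τ))
      (by positivity) (by norm_num) (by norm_num) (by decide) (by decide) (by decide)
      (by decide) (by decide) (by decide) (by decide) ?_ ?_
    · rw [div_mul_cancel₀ _ h1.ne']
      push_cast
      linarith
    · have h : (118 + 4 * τ) / (1 + τ) ≤ 65 / 2 := by rw [div_le_iff₀ h1]; linarith
      push_cast
      linarith
end

section
/- There exists a congestion game in which every resource e has affine cost function ℓ_e(x)=α_e·x+β_e with α_e,β_e ≥ 0 and the marginal-cost toll τ_e(x)=α_e·(x−1), together with a pure Nash equilibrium a and a feasible allocation a′, such that SC(a) = 3·SC(a′). (Hence the price of anarchy of the marginal-cost mechanism over affine congestion games is at least 3.) -/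
/-- there is an affine congestion game (`ℓ_e(x) = α_e x + β_e`, nonnegative
coefficients) with the marginal-cost toll `τ_e(x) = α_e (x−1)`, a pure Nash equilibrium
`a` and a feasible allocation `a'` with `SC(a) = 3·SC(a')` (and `SC(a') > 0`). -/
theorem marginal_toll_affine_lower_bound :
    ∃ (n m : ℕ) (A : Fin n → Set (Finset (Fin m))) (α β : Fin m → ℝ)
      (cost toll : Fin m → ℕ → ℝ) (a a' : Fin n → Finset (Fin m)),
      (∀ e, 0 ≤ α e) ∧ (∀ e, 0 ≤ β e) ∧
      (∀ e (x : ℕ), cost e x = α e * (x : ℝ) + β e) ∧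
      (∀ e (x : ℕ), toll e x = α e * ((x : ℝ) - 1)) ∧
      (∀ i, a i ∈ A i) ∧ (∀ i, a' i ∈ A i) ∧
      cgIsNash A cost toll a ∧
      0 < cgSocialCost cost a' ∧
      cgSocialCost cost a = 3 * cgSocialCost cost a' := by
  have h0 : cgLoad (![{0, 2}, {1, 3}] : Fin 2 → Finset (Fin 4)) 0 = 1 := by decide
  have h1 : cgLoad (![{0, 2}, {1, 3}] : Fin 2 → Finset (Fin 4)) 1 = 1 := by decide
  have h2 : cgLoad (![{0, 2}, {1, 3}] : Fin 2 → Finset (Fin 4)) 2 = 1 := by decide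
  have h3 : cgLoad (![{0, 2}, {1, 3}] : Fin 2 → Finset (Fin 4)) 3 = 1 := by decide
  have k0 : cgLoad (![{1}, {0}] : Fin 2 → Finset (Fin 4)) 0 = 1 := by decide
  have k1 : cgLoad (![{1}, {0}] : Fin 2 → Finset (Fin 4)) 1 = 1 := by decide
  have k2 : cgLoad (![{1}, {0}] : Fin 2 → Finset (Fin 4)) 2 = 0 := by decide
  have k3 : cgLoad (![{1}, {0}] : Fin 2 → Finset (Fin 4)) 3 = 0 := by decide
  have r2 : (![1, 1, 2, 2] : Fin 4 → ℝ) 2 = 2 := rfl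
  have r3 : (![1, 1, 2, 2] : Fin 4 → ℝ) 3 = 2 := rfl
  -- Resources 0 and 1 trade users between equilibrium and optimum; resources 2 and 3
  -- have one user each in the equilibrium and none in the optimum.
  refine ⟨2, 4, fun i => {![{0, 2}, {1, 3}] i, ![{1}, {0}] i}, ![1, 1, 2, 2], 0,
    fun e x => ![1, 1, 2, 2] e * (x : ℝ), fun e x => ![1, 1, 2, 2] e * ((x : ℝ) - 1),
    ![{0, 2}, {1, 3}], ![{1}, {0}], ?_, ?_, ?_, ?_, ?_, ?_, ?_, ?_, ?_⟩
  · intro e; fin_cases e <;> norm_num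
  · intro e; simp
  · intro e x; simp
  · intro e x; rfl
  · intro i; simp
  · intro i; simp
  · have d0 : cgLoad (Function.update (![{0, 2}, {1, 3}] : Fin 2 → Finset (Fin 4)) 0 {1}) 1 = 2 := by
      decide
    have d1 : cgLoad (Function.update (![{0, 2}, {1, 3}] : Fin 2 → Finset (Fin 4)) 1 {0}) 0 = 2 := by
      decide
    intro i b hb
    rcases hb with rfl | hb
    · rw [Function.update_eq_self]
    · rw [Set.mem_singleton_iff] at hb
      subst hb
      fin_cases i
      · simp only [cgPlayerCost, Fin.zero_eta, Matrix.cons_val_zero, Function.update_self,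
          Finset.sum_singleton, d0]
        rw [Finset.sum_pair (by decide), h0, h2]
        norm_num [r2]
      · simp only [cgPlayerCost, Fin.mk_one, Matrix.cons_val_one, Matrix.cons_val_zero,
          Function.update_self, Finset.sum_singleton, d1]
        rw [Finset.sum_pair (by decide), h1, h3]
        norm_num [r3]
  · simp only [cgSocialCost, Fin.sum_univ_four, k0, k1, k2, k3]
    norm_num
  · simp only [cgSocialCost, Fin.sum_univ_four, h0, h1, h2, h3, k0, k1, k2, k3]
    norm_num [r2, r3]
end

section
/- Let b:ℕ→ℝ≥0 be nondecreasing and discretely convex, let 0 < ρ ≤ 1, and let n be a positive integer. Define f:{1,…,n}→ℝ by f(1)=b(1) and, for u∈{1,…,n−1}, f(u+1) = min over v∈{1,…,n} of [min{u,n−v}·f(u) − ρ·u·b(u) + v·b(v)] / min{v,n−u}. Then, if û is the smallest index with 1 ≤ û ≤ n−1 such that f(û+1) < f(û), it holds that f(u+1) < f(u) for all u∈{û,…,n−1}; that is, once f decreases it continues to decrease up to n. -/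
/-- Capping both sides at the complement does not change the difference of two indices. -/
theorem natCast_min_sub_eq {n u v : ℕ} (hu : u ≤ n) (hv : v ≤ n) :
    ((min u (n - v) : ℕ) : ℝ) = ((min v (n - u) : ℕ) : ℝ) + ((u : ℝ) - v) := by
  have h : min u (n - v) + v = min v (n - u) + u := by omega
  have h' : ((min u (n - v) : ℕ) : ℝ) + v = ((min v (n - u) : ℕ) : ℝ) + u := by exact_mod_cast h
  linarith

/-- The increments of `x ↦ x * b x` are monotone when `b` is nondecreasing and convex. -/
theorem monotone_increment_natCast_mul {b : ℕ → ℝ} (hb_mono : ∀ x, b x ≤ b (x + 1))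
    (hb_conv : ∀ x, b (x + 1) - b x ≤ b (x + 2) - b (x + 1)) :
    Monotone fun x : ℕ => ((x + 1 : ℕ) : ℝ) * b (x + 1) - (x : ℝ) * b x := by
  refine monotone_nat_of_le_succ fun x => ?_
  have h1 := mul_le_mul_of_nonneg_left (hb_conv x) (Nat.cast_nonneg (α := ℝ) x)
  have h2 := hb_mono (x + 1)
  push_cast
  simp only [add_assoc, one_add_one_eq_two] at h2 ⊢
  linarith

/-- A chord of a function with monotone increments is at most as steep as the increment at its
right endpoint. -/
theorem sub_le_mul_increment {g : ℕ → ℝ} (hg : Monotone fun x => g (x + 1) - g x) {v u : ℕ}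
    (hvu : v ≤ u) : g u - g v ≤ ((u : ℝ) - v) * (g (u + 1) - g u) := by
  induction u, hvu using Nat.le_induction with
  | base => simp
  | succ u hvu ih =>
    have h1 : g (u + 1) - g u ≤ g (u + 1 + 1) - g (u + 1) := hg (Nat.le_succ u)
    have h2 : (0 : ℝ) ≤ (u : ℝ) - v := sub_nonneg.mpr (Nat.cast_le.mpr hvu)
    have h3 := mul_le_mul_of_nonneg_left h1 h2
    push_cast
    linarith

/-- A point obtained from `a` by moving at most the fraction `k / m ≤ 1` of the way to `c / k` stays
below `c / k`, provided `a` does. -/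
theorem mul_le_of_mul_sub_le {a x c k m : ℝ} (hk : 0 ≤ k) (hm : 0 < m) (hkm : k ≤ m)
    (ha : k * a ≤ c) (hx : m * (x - a) ≤ c - k * a) : k * x ≤ c := by
  have h1 := mul_le_mul_of_nonneg_left hx hk
  have h2 := mul_le_mul_of_nonneg_right hkm (sub_nonneg.mpr ha)
  refine le_of_mul_le_mul_left ?_ hm
  linarith


/-- for the recursively defined `f` (with `f(1) = b(1)` and
`f(u+1) = min_{v∈{1,…,n}} [min{u,n−v}·f(u) − ρ·u·b(u) + v·b(v)] / min{v,n−u}`),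
once `f` decreases at the first index `û`, it keeps decreasing up to `n`. -/
theorem f_once_decreasing_keeps_decreasing
    (n : ℕ) (hn : 1 ≤ n) (b : ℕ → ℝ)
    (hb_nonneg : ∀ x, 0 ≤ b x)
    (hb_mono : ∀ x, b x ≤ b (x + 1))
    (hb_conv : ∀ x, b (x + 1) - b x ≤ b (x + 2) - b (x + 1))
    (ρ : ℝ) (hρ0 : 0 < ρ) (hρ1 : ρ ≤ 1)
    (f : ℕ → ℝ) (hf1 : f 1 = b 1)
    (hfrec : ∀ u, 1 ≤ u → u + 1 ≤ n →
      f (u + 1) = (Finset.Icc 1 n).inf' (Finset.nonempty_Icc.mpr hn)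
        (fun v => (((min u (n - v) : ℕ) : ℝ) * f u - ρ * (u : ℝ) * b u +
            (v : ℝ) * b v) / ((min v (n - u) : ℕ) : ℝ)))
    (uh : ℕ) (huh1 : 1 ≤ uh) (huh2 : uh + 1 ≤ n)
    (hdec : f (uh + 1) < f uh)
    (hfirst : ∀ u, 1 ≤ u → u < uh → ¬ f (u + 1) < f u) :
    ∀ u, uh ≤ u → u + 1 ≤ n → f (u + 1) < f u := by
  set g : ℕ → ℝ := fun x => (x : ℝ) * b x with hg
  have hg_nonneg : ∀ x, 0 ≤ g x := fun x => mul_nonneg (Nat.cast_nonneg x) (hb_nonneg x)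
  have hg_conv : Monotone fun x => g (x + 1) - g x :=
    monotone_increment_natCast_mul hb_mono hb_conv
  have hmin_pos : ∀ u v, u + 1 ≤ n → 1 ≤ v → (0 : ℝ) < ((min v (n - u) : ℕ) : ℝ) := by
    intro u v hu hv
    have : 0 < min v (n - u) := by omega
    exact_mod_cast this
  have hquot : ∀ u v, u + 1 ≤ n → 1 ≤ v → v ≤ n →
      ((min v (n - u) : ℕ) : ℝ) * ((((min u (n - v) : ℕ) : ℝ) * f u - ρ * (u : ℝ) * b u +
        (v : ℝ) * b v) / ((min v (n - u) : ℕ) : ℝ) - f u) =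
        ((u : ℝ) - v) * f u - ρ * g u + g v := by
    intro u v hu hv hvn
    have hpos := hmin_pos u v hu hv
    rw [mul_sub, mul_div_cancel₀ _ hpos.ne', natCast_min_sub_eq (by omega) hvn]
    simp only [hg]
    ring
  have hstep_le : ∀ u v, 1 ≤ u → u + 1 ≤ n → 1 ≤ v → v ≤ n →
      ((min v (n - u) : ℕ) : ℝ) * (f (u + 1) - f u) ≤ ((u : ℝ) - v) * f u - ρ * g u + g v := by
    intro u v hu hun hv hvn
    rw [← hquot u v hun hv hvn, hfrec u hu hun]
    exact mul_le_mul_of_nonneg_left (sub_le_sub_right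
      (Finset.inf'_le _ (Finset.mem_Icc.mpr ⟨hv, hvn⟩)) _) (hmin_pos u v hun hv).le
  have hstep_eq : ∀ u, 1 ≤ u → u + 1 ≤ n → ∃ v, 1 ≤ v ∧ v ≤ n ∧
      ((min v (n - u) : ℕ) : ℝ) * (f (u + 1) - f u) = ((u : ℝ) - v) * f u - ρ * g u + g v := by
    intro u hu hun
    obtain ⟨v, hv, hfv⟩ := Finset.exists_mem_eq_inf' (Finset.nonempty_Icc.mpr hn)
      (fun v => (((min u (n - v) : ℕ) : ℝ) * f u - ρ * (u : ℝ) * b u +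
            (v : ℝ) * b v) / ((min v (n - u) : ℕ) : ℝ))
    rw [Finset.mem_Icc] at hv
    refine ⟨v, hv.1, hv.2, ?_⟩
    rw [← hquot u v hun hv.1 hv.2, hfrec u hu hun, hfv]
  have hright : ∀ v, uh < v → v ≤ n → ((v : ℝ) - uh) * f uh ≤ g v - ρ * g uh := by
    intro v hv hvn
    obtain rfl | ⟨u, rfl⟩ : uh = 1 ∨ ∃ u, uh = u + 1 + 1 := by
      rcases uh with _ | _ | u
      · omega
      · exact Or.inl rfl
      · exact Or.inr ⟨u, rfl⟩
    · have h1 : b 1 ≤ b v := monotone_nat_of_le_succ hb_mono (by omega)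
      have h2 := mul_le_mul_of_nonneg_left h1 (Nat.cast_nonneg (α := ℝ) v)
      have h3 := mul_le_mul_of_nonneg_right hρ1 (hb_nonneg 1)
      simp only [hg, hf1, Nat.cast_one]
      linarith
    · obtain ⟨w, rfl⟩ : ∃ w, v = w + 1 := ⟨v - 1, by omega⟩
      have hle := not_lt.mp (hfirst (u + 1) (by omega) (by omega))
      have hstep := hstep_le (u + 1) w (by omega) (by omega) (by omega) (by omega)
      have hpos := hmin_pos (u + 1) w (by omega) (by omega)
      have hnonneg := mul_nonneg hpos.le (sub_nonneg.mpr hle)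
      have hk : (0 : ℝ) ≤ (w : ℝ) - (u + 1 : ℕ) :=
        sub_nonneg.mpr (Nat.cast_le.mpr (by omega))
      have hkm : (w : ℝ) - (u + 1 : ℕ) ≤ ((min w (n - (u + 1)) : ℕ) : ℝ) := by
        rw [sub_le_iff_le_add]
        have : w ≤ min w (n - (u + 1)) + (u + 1) := by omega
        exact_mod_cast this
      have hmain := mul_le_of_mul_sub_le (x := f (u + 1 + 1)) (a := f (u + 1))
        (c := g w - ρ * g (u + 1)) hk hpos hkm (by linarith) (by linarith)
      have h1 : g (u + 1 + 1) - g (u + 1) ≤ g (w + 1) - g w :=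
        hg_conv (show u + 1 ≤ w by omega)
      have h2 : 0 ≤ g (u + 1 + 1) - g (u + 1) := by
        have h0 : g (0 + 1) - g 0 ≤ g (u + 1 + 1) - g (u + 1) := hg_conv (Nat.zero_le (u + 1))
        have h00 : g 0 = 0 := by simp [hg]
        linarith [hg_nonneg (0 + 1)]
      have h3 := mul_le_mul_of_nonneg_right hρ1 h2
      push_cast at hmain ⊢
      linarith
  have hslope : f uh ≤ ρ * (g (uh + 1) - g uh) := by
    obtain ⟨v, hv, hvn, hfv⟩ := hstep_eq uh huh1 huh2
    have hneg := mul_neg_of_pos_of_neg (hmin_pos uh v huh2 hv) (sub_neg.mpr hdec)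
    rcases lt_trichotomy v uh with h | rfl | h
    · have h1 : (0 : ℝ) < (uh : ℝ) - v := sub_pos.mpr (Nat.cast_lt.mpr h)
      have h2 := mul_le_mul_of_nonneg_left (sub_le_mul_increment hg_conv h.le) hρ0.le
      have h3 := mul_le_mul_of_nonneg_right hρ1 (hg_nonneg v)
      refine le_of_mul_le_mul_left ?_ h1
      linarith
    · have h3 := mul_le_mul_of_nonneg_right hρ1 (hg_nonneg v)
      linarith
    · have := hright v h hvn
      linarith
  suffices H : ∀ u, uh ≤ u → u + 1 ≤ n →
      f u ≤ ρ * (g (u + 1) - g u) ∧ f (u + 1) < f u from fun u hu hun => (H u hu hun).2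
  intro u hu
  induction u, hu using Nat.le_induction with
  | base => exact fun _ => ⟨hslope, hdec⟩
  | succ u hu ih =>
    intro hun
    obtain ⟨hfu, hlt⟩ := ih (by omega)
    have hinc : g (u + 1) - g u ≤ g (u + 1 + 1) - g (u + 1) := hg_conv (Nat.le_succ u)
    refine ⟨by linarith [mul_le_mul_of_nonneg_left hinc hρ0.le], ?_⟩
    obtain ⟨v, hv, hvn, hfv⟩ := hstep_eq u (by omega) (by omega)
    have hnext := hstep_le (u + 1) v (by omega) hun hv hvn
    have hpos := hmin_pos (u + 1) v hun hv
    have hcoef : (0 : ℝ) < ((min v (n - u) : ℕ) : ℝ) + ((u : ℝ) - v) + 1 := by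
      rw [← natCast_min_sub_eq (by omega) hvn]
      positivity
    have hneg := mul_neg_of_pos_of_neg hcoef (sub_neg.mpr hlt)
    refine sub_neg.mp (neg_of_mul_neg_right (a := ((min v (n - (u + 1)) : ℕ) : ℝ)) ?_ hpos.le)
    refine hnext.trans_lt ?_
    push_cast
    linarith
end

section
/- Let n and d be integers with n ≥ 2 and d ≥ 1, let f:{1,…,n}→ℝ satisfy f(x) ≤ x^d for all x∈{1,…,n}, and let ρ ≥ 0. Suppose that for every u∈{1,…,n−1} the inequality u^{d+1} − ρ·u^{d+1} + u·f(u) − u·f(u+1) ≥ 0 holds (the case v=u). Then for every u∈{1,…,n−1} and every integer v ≥ u it holds that v^{d+1} − ρ·u^{d+1} + u·f(u) − v·f(u+1) ≥ 0. -/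
/-- if `f(x) ≤ x^d` on `{1,…,n}`, `ρ ≥ 0`, and for every `u∈{1,…,n−1}`
the diagonal constraint `u^{d+1} − ρ u^{d+1} + u f(u) − u f(u+1) ≥ 0` holds, then for
every `u∈{1,…,n−1}` and every integer `v ≥ u` the constraint
`v^{d+1} − ρ u^{d+1} + u f(u) − v f(u+1) ≥ 0` holds. -/
theorem constraints_v_ge_u_from_diagonal
    (n d : ℕ) (hn : 2 ≤ n) (hd : 1 ≤ d)
    (f : ℕ → ℝ) (hf : ∀ x, 1 ≤ x → x ≤ n → f x ≤ (x : ℝ) ^ d)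
    (ρ : ℝ) (hρ : 0 ≤ ρ)
    (hdiag : ∀ u : ℕ, 1 ≤ u → u + 1 ≤ n →
      (u : ℝ) ^ (d + 1) - ρ * (u : ℝ) ^ (d + 1) + (u : ℝ) * f u - (u : ℝ) * f (u + 1) ≥ 0) :
    ∀ u v : ℕ, 1 ≤ u → u + 1 ≤ n → u ≤ v →
      (v : ℝ) ^ (d + 1) - ρ * (u : ℝ) ^ (d + 1) + (u : ℝ) * f u - (v : ℝ) * f (u + 1) ≥ 0 := by
  intro u v hu hun huv
  have hdu := hdiag u hu hun
  rcases huv.eq_or_lt with rfl | hlt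
  · exact hdu
  have hfv : f (u + 1) ≤ (v : ℝ) ^ d :=
    (hf (u + 1) (by omega) hun).trans
      (pow_le_pow_left₀ (Nat.cast_nonneg _) (by exact_mod_cast hlt) d)
  have huv' : (u : ℝ) ≤ v := by exact_mod_cast huv
  have hpow : (u : ℝ) ^ d ≤ (v : ℝ) ^ d := pow_le_pow_left₀ (Nat.cast_nonneg _) huv' d
  have hslope : 0 ≤ ((v : ℝ) - u) * ((v : ℝ) ^ d - f (u + 1)) :=
    mul_nonneg (sub_nonneg.2 huv') (sub_nonneg.2 hfv)
  have hmono : 0 ≤ (u : ℝ) * ((v : ℝ) ^ d - (u : ℝ) ^ d) :=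
    mul_nonneg (Nat.cast_nonneg _) (sub_nonneg.2 hpow)
  rw [pow_succ] at hdu ⊢
  rw [pow_succ]
  linarith
end

section
/- For all nonnegative integers u and v it holds (over the reals) that 4·v³ + (1/4)·u³ ≥ 3·(v − u) + v·(u+1)². -/
/-- for all nonnegative integers `u, v`,
`4v³ + u³/4 ≥ 3(v − u) + v(u+1)²` over the reals. -/
theorem smoothness_inequality_quadratic (u v : ℕ) :
    3 * ((v : ℝ) - (u : ℝ)) + (v : ℝ) * ((u : ℝ) + 1) ^ 2 ≤
      4 * (v : ℝ) ^ 3 + (1 / 4) * (u : ℝ) ^ 3 := by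
  obtain rfl | rfl | rfl | hv : v = 0 ∨ v = 1 ∨ v = 2 ∨ 3 ≤ v := by lia
  · norm_num
    have : (0 : ℝ) ≤ u := u.cast_nonneg
    nlinarith [pow_nonneg this 3]
  · have : (0 : ℝ) ≤ u * (u / 2 - 1) ^ 2 := by positivity
    push_cast
    linarith
  · obtain hu | hu : u ≤ 5 ∨ 6 ≤ u := by lia
    · interval_cases u <;> norm_num
    · have hu' : (6 : ℝ) ≤ u := mod_cast hu
      have : (0 : ℝ) ≤ (u - 6) * (u ^ 2 - 2 * u - 16) :=
        mul_nonneg (by linarith) (by nlinarith)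
      push_cast
      linarith
  · have hv' : (0 : ℝ) ≤ v - 3 := sub_nonneg.2 (mod_cast hv)
    have h₀ : (0 : ℝ) ≤ u * (u - 8 * v / 3) ^ 2 := by positivity
    have h₁ := mul_nonneg hv' (sq_nonneg ((u : ℝ) - 8 * v / 3 - 3))
    have h₂ := sq_nonneg ((u : ℝ) - 8 * v / 3 - 3 / 2)
    have h₃ : (0 : ℝ) ≤ 44 / 27 * v ^ 3 - 16 / 3 * v ^ 2 + v + 27 / 4 := by
      nlinarith [pow_nonneg hv' 2, pow_nonneg hv' 3]
    linarith
end

section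
/- For all nonnegative integers u and v such that u ≥ 22 or v ≥ 8, it holds (over the reals) that 4·v³ + (1/4)·u³ − v·(u+2)² ≥ 0. -/
/-- The quadratic-cost inequality holds for real `u ≥ 0` as soon as `v ≥ 8`: compare with the
tangent line in `u` at `u = 8 * v / 3 + 2`. -/
theorem quadratic_cost_nonneg_of_eight_le {u v : ℝ} (hu : 0 ≤ u) (hv : 8 ≤ v) :
    0 ≤ 4 * v ^ 3 + (1 / 4) * u ^ 3 - v * (u + 2) ^ 2 := by
  obtain ⟨d, rfl⟩ : ∃ d, u = 8 * v / 3 + 2 + d := ⟨u - (8 * v / 3 + 2), by ring⟩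
  obtain ⟨w, rfl⟩ : ∃ w, v = 8 + w := ⟨v - 8, by ring⟩
  have hw : 0 ≤ w := by linarith
  have hd : 0 ≤ d ^ 2 * (8 * (8 + w) / 3 + 2 + d) := mul_nonneg (sq_nonneg d) hu
  have hdw : 0 ≤ d ^ 2 * w := mul_nonneg (sq_nonneg d) hw
  nlinarith [sq_nonneg (d + 1), pow_nonneg hw 2, pow_nonneg hw 3]

/-- The quadratic-cost inequality holds for real `u ≥ 22` when `v ≤ 7` is a natural number. -/
theorem quadratic_cost_nonneg_of_le_seven {u : ℝ} {v : ℕ} (hu : 22 ≤ u) (hv : v ≤ 7) :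
    0 ≤ 4 * (v : ℝ) ^ 3 + (1 / 4) * u ^ 3 - v * (u + 2) ^ 2 := by
  obtain ⟨k, rfl⟩ : ∃ k, u = 22 + k := ⟨u - 22, by ring⟩
  have hk : 0 ≤ k := by linarith
  interval_cases v <;> norm_num <;> nlinarith [pow_nonneg hk 2, pow_nonneg hk 3]

/-- for all nonnegative integers `u, v` with `u ≥ 22` or `v ≥ 8`,
`4v³ + u³/4 − v(u+2)² ≥ 0` over the reals. -/
theorem intermediate_inequality_quadratic (u v : ℕ) (h : 22 ≤ u ∨ 8 ≤ v) :
    4 * (v : ℝ) ^ 3 + (1 / 4) * (u : ℝ) ^ 3 - (v : ℝ) * ((u : ℝ) + 2) ^ 2 ≥ 0 := by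
  rcases le_or_gt 8 v with hv | hv
  · exact quadratic_cost_nonneg_of_eight_le u.cast_nonneg (by exact_mod_cast hv)
  · have hu : 22 ≤ u := h.resolve_right (by lia)
    exact quadratic_cost_nonneg_of_le_seven (by exact_mod_cast hu) (by lia)
end

section
/- For all nonnegative integers u and v it holds (over the reals) that 3·v² + u² − u − 2·u·v − v ≥ 0; equivalently, every point of ℤ≥0² lies in the exterior (or boundary) of the ellipse described by 3v² + u² − u − 2uv − v = 0. -/
theorem Int.mul_sub_one_self_nonneg (n : ℤ) : 0 ≤ n * (n - 1) := by
  rcases le_or_gt n 0 with h | h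
  · exact mul_nonneg_of_nonpos_of_nonpos h (by lia)
  · exact mul_nonneg h.le (by lia)

/-- for all nonnegative integers `u, v`,
`3v² + u² − u − 2uv − v ≥ 0` over the reals (every lattice point of `ℤ≥0²` lies outside,
or on the boundary of, the corresponding ellipse). -/
theorem marginal_cost_ellipse_inequality (u v : ℕ) :
    3 * (v : ℝ) ^ 2 + (u : ℝ) ^ 2 - (u : ℝ) - 2 * (u : ℝ) * (v : ℝ) - (v : ℝ) ≥ 0 := by
  have key : (0 : ℤ) ≤ 3 * (v : ℤ) ^ 2 + (u : ℤ) ^ 2 - u - 2 * u * v - v := by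
    linarith [Int.mul_sub_one_self_nonneg ((u : ℤ) - v), Int.mul_sub_one_self_nonneg (v : ℤ)]
  exact_mod_cast key
end

section
/- Let n ≥ 1 be an integer, let b:ℕ→ℝ be positive, nondecreasing, and discretely convex, and let ρ∈ℝ, ν ≥ 0, σ ≥ 0 be reals. For integers u,v∈{0,…,n}, say that constraint C(u,v) holds if: b(v)·v − ρ·b(u)·u + ν·[b(u)·u − b(u+1)·v] + σ·(u−v) ≥ 0 when u+v ≤ n, and b(v)·v − ρ·b(u)·u + ν·[b(u)·(n−v) − b(u+1)·(n−u)] + σ·(u−v) ≥ 0 when u+v > n (with the convention b(0)·0 = 0). Then: (i) if C(0,1) holds, then C(0,v) holds for every v∈{1,…,n}; (ii) if C(0,1) holds and C(u,v) holds for all u∈{1,…,n} and v∈{0,…,n} with u ≥ v, then C(u,v) holds for all u∈{1,…,n} and v∈{0,…,n} with u < v. -/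
/-- The constraint `C(u,v)` of the congestion-independent-toll linear program,
with `σ = ν·τ` the scaled toll variable (convention `b(0)·0 = 0` is automatic). -/
def constraintC (n : ℕ) (b : ℕ → ℝ) (ρ ν σ : ℝ) (u v : ℕ) : Prop :=
  if u + v ≤ n then
    b v * (v : ℝ) - ρ * (b u * (u : ℝ)) + ν * (b u * (u : ℝ) - b (u + 1) * (v : ℝ)) +
      σ * ((u : ℝ) - (v : ℝ)) ≥ 0
  else
    b v * (v : ℝ) - ρ * (b u * (u : ℝ)) +
      ν * (b u * ((n : ℝ) - (v : ℝ)) - b (u + 1) * ((n : ℝ) - (u : ℝ))) +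
      σ * ((u : ℝ) - (v : ℝ)) ≥ 0

/-- for `b` positive, nondecreasing, discretely convex, and `ν, σ ≥ 0`:
(i) if `C(0,1)` holds then `C(0,v)` holds for all `v ∈ {1,…,n}`;
(ii) if `C(0,1)` holds and `C(u,v)` holds for all `u ∈ {1,…,n}`, `v ∈ {0,…,n}` with
`u ≥ v`, then `C(u,v)` holds for all `u ∈ {1,…,n}`, `v ∈ {0,…,n}` with `u < v`. -/
theorem reduced_constraints_suffice
    (n : ℕ) (hn : 1 ≤ n) (b : ℕ → ℝ)
    (hb_pos : ∀ x, 0 < b x)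
    (hb_mono : ∀ x, b x ≤ b (x + 1))
    (hb_conv : ∀ x, b (x + 1) - b x ≤ b (x + 2) - b (x + 1))
    (ρ ν σ : ℝ) (hν : 0 ≤ ν) (hσ : 0 ≤ σ)
    (h01 : constraintC n b ρ ν σ 0 1) :
    (∀ v, 1 ≤ v → v ≤ n → constraintC n b ρ ν σ 0 v) ∧
    ((∀ u v, 1 ≤ u → u ≤ n → v ≤ n → v ≤ u → constraintC n b ρ ν σ u v) →
      ∀ u v, 1 ≤ u → u ≤ n → v ≤ n → u < v → constraintC n b ρ ν σ u v) := by
  have mono : Monotone b := monotone_nat_of_le_succ hb_mono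
  simp only [constraintC] at *
  rw [if_pos (by omega)] at h01
  push_cast at h01
  have hσ1 : σ ≤ (1 - ν) * b 1 := by linarith
  have hν1 : 0 ≤ 1 - ν := by
    by_contra! h
    nlinarith [hb_pos 1]
  refine ⟨fun v hv hvn => ?_, fun h u v hu hun hvn huv => ?_⟩
  · rw [if_pos (by omega)]
    push_cast
    nlinarith [mul_nonneg (show (0 : ℝ) ≤ v by positivity)
      (show 0 ≤ b v - ν * b 1 - σ by linarith [mono hv])]
  · have hC := h u u hu hun hun le_rfl
    have h1u : b 1 ≤ b u := mono hu
    have huu : b u ≤ b (u + 1) := hb_mono u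
    have huv' : b (u + 1) ≤ b v := mono huv
    have hσu : σ ≤ (1 - ν) * b u := hσ1.trans (mul_le_mul_of_nonneg_left h1u hν1)
    have hk : (0 : ℝ) ≤ v - u := sub_nonneg.2 (by exact_mod_cast huv.le)
    have hu0 : (0 : ℝ) ≤ u := by positivity
    have hv0 : (0 : ℝ) ≤ v := by positivity
    have hσk : 0 ≤ (v - u : ℝ) * ((1 - ν) * b u - σ) := mul_nonneg hk (by linarith)
    have hνk : 0 ≤ (1 - ν) * (b (u + 1) - b u) := mul_nonneg hν1 (by linarith)
    have hvv : 0 ≤ (v : ℝ) * (b v - b (u + 1)) := mul_nonneg hv0 (by linarith)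
    by_cases huvn : u + v ≤ n
    · rw [if_pos (by omega)] at hC
      rw [if_pos huvn]
      have hd : 0 ≤ (u : ℝ) * (b (u + 1) - b u) := mul_nonneg hu0 (by linarith)
      linarith [mul_nonneg hk hνk]
    · rw [if_neg huvn]
      by_cases h2 : u + u ≤ n
      · rw [if_pos h2] at hC
        have hn2 : (0 : ℝ) ≤ v - (n - 2 * u) := by
          have : (n : ℝ) ≤ v + 2 * u := by exact_mod_cast (by omega : n ≤ v + 2 * u)
          linarith
        have hd := mul_nonneg hν (mul_nonneg hn2 (sub_nonneg.2 huu))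
        linarith [mul_nonneg hv0 hνk]
      · rw [if_neg h2] at hC
        have hd : 0 ≤ (v : ℝ) * (b (u + 1) - b u) := mul_nonneg hv0 (by linarith)
        linarith
end

section
/- Let d ≥ 1 be an integer, let β ≥ 0 and u > 0 be reals, and let ρ be a real number with ρ ≤ β − d·(1+1/u)^{d+1}·(β/(d+1))^{1+1/d}. Then for every real v ≥ 0 it holds that v^{d+1} + (β−ρ)·u^{d+1} − β·v·(u+1)^d ≥ 0. -/
theorem young_inequality_pow (n : ℕ) {v w : ℝ} (hv : 0 ≤ v) (hw : 0 ≤ w) :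
    ((n : ℝ) + 1) * v * w ^ n ≤ v ^ (n + 1) + n * w ^ (n + 1) := by
  induction n with
  | zero => simp
  | succ n ih =>
    have hmul := mul_le_mul_of_nonneg_left ih hv
    have hsq : 0 ≤ ((n : ℝ) + 1) * w ^ n * (v - w) ^ 2 := by positivity
    push_cast
    linear_combination hmul + hsq

/-- for an integer `d ≥ 1`, reals `β ≥ 0`, `u > 0`, and
`ρ ≤ β − d·(1+1/u)^{d+1}·(β/(d+1))^{1+1/d}`, for every real `v ≥ 0` it holds that
`v^{d+1} + (β−ρ)·u^{d+1} − β·v·(u+1)^d ≥ 0`. -/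
theorem extension_constraint_large_n
    (d : ℕ) (hd : 1 ≤ d) (β u : ℝ) (hβ : 0 ≤ β) (hu : 0 < u) (ρ : ℝ)
    (hρ : ρ ≤ β - (d : ℝ) * (1 + 1 / u) ^ (d + 1) *
        (β / ((d : ℝ) + 1)) ^ ((1 : ℝ) + 1 / (d : ℝ))) :
    ∀ v : ℝ, 0 ≤ v →
      v ^ (d + 1) + (β - ρ) * u ^ (d + 1) - β * v * (u + 1) ^ d ≥ 0 := by
  intro v hv
  have hd0 : d ≠ 0 := by lia
  have hb : 0 ≤ β / ((d : ℝ) + 1) := by positivity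
  obtain ⟨s, hs, hsd, hsd1⟩ : ∃ s : ℝ, 0 ≤ s ∧ s ^ d = β / ((d : ℝ) + 1) ∧
      (β / ((d : ℝ) + 1)) ^ ((1 : ℝ) + 1 / (d : ℝ)) = s ^ (d + 1) := by
    refine ⟨(β / ((d : ℝ) + 1)) ^ ((d : ℝ)⁻¹), by positivity,
      Real.rpow_inv_natCast_pow hb hd0, ?_⟩
    rw [Real.rpow_add_of_nonneg hb zero_le_one (by positivity), Real.rpow_one, pow_succ,
      Real.rpow_inv_natCast_pow hb hd0, one_div]
  have hβs : ((d : ℝ) + 1) * s ^ d = β := by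
    rw [hsd]
    field_simp
  have hyoung := young_inequality_pow d hv (w := s * (u + 1)) (by positivity)
  have hu1 : (1 + 1 / u) ^ (d + 1) * u ^ (d + 1) = (u + 1) ^ (d + 1) := by
    rw [← mul_pow]
    congr 1
    field_simp
  rw [hsd1] at hρ
  have hρu := mul_le_mul_of_nonneg_right hρ (pow_nonneg hu.le (d + 1))
  rw [mul_pow, mul_pow] at hyoung
  linear_combination hyoung + hρu - (d : ℝ) * s ^ (d + 1) * hu1 - v * (u + 1) ^ d * hβs
end

section
/- Let n ≥ 2 be an integer and let b:{1,…,n}→ℝ be positive, strictly increasing, and discretely convex. Define β(u,v)=min{u,n−v}/min{v,n−u}, γ(u,v)=b(v)·v/min{v,n−u}, δ(u,v)=b(u)·u/min{v,n−u} for u∈{1,…,n−1}, v∈{1,…,n}; define ρ* = min over tuples (v_1,…,v_n)∈{1,…,n}^{n−1}×{0,…,n} of N/D, where (writing β_u=β(u,v_u), γ_u=γ(u,v_u), δ_u=δ(u,v_u)) N = (n−v_n)·( b(1)·∏_{u=1}^{n−1}β_u + Σ_{u=1}^{n−2}(∏_{i=u+1}^{n−1}β_i)·γ_u + γ_{n−1}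 ) + b(v_n)·v_n and D = (n−v_n)·( Σ_{u=1}^{n−2}(∏_{i=u+1}^{n−1}β_i)·δ_u + δ_{n−1} ) + b(n)·n; and define f*:{1,…,n}→ℝ by f*(1)=b(1) and f*(u+1) = min over v∈{1,…,n} of [β(u,v)·f*(u) + γ(u,v) − δ(u,v)·ρ*]. Then (f*, ρ*) is feasible for the linear program: with conventions b(0)=0 and f*(0)=f*(n+1)=0, for all u,v∈{0,…,n}: b(v)·v − ρ*·b(u)·u + f*(u)·u − f*(u+1)·v ≥ 0 whenever u+v ≤ n, and b(v)·v − ρ*·b(u)·u + f*(u)·(n−v) − f*(u+1)·(n−u) ≥ 0 whenever u+v > n. -/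
/-- `β(u,v) = min{u, n−v} / min{v, n−u}`. -/
noncomputable def betaC (n u w : ℕ) : ℝ :=
  ((min u (n - w) : ℕ) : ℝ) / ((min w (n - u) : ℕ) : ℝ)

/-- `γ(u,v) = b(v)·v / min{v, n−u}`. -/
noncomputable def gammaC (n : ℕ) (b : ℕ → ℝ) (u w : ℕ) : ℝ :=
  b w * (w : ℝ) / ((min w (n - u) : ℕ) : ℝ)

/-- `δ(u,v) = b(u)·u / min{v, n−u}`. -/
noncomputable def deltaC (n : ℕ) (b : ℕ → ℝ) (u w : ℕ) : ℝ :=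
  b u * (u : ℝ) / ((min w (n - u) : ℕ) : ℝ)

/-- The numerator `N` in the definition of `ρ*`. -/
noncomputable def Nval (n : ℕ) (b : ℕ → ℝ) (v : ℕ → ℕ) : ℝ :=
  ((n : ℝ) - (v n : ℝ)) *
      (b 1 * ∏ u ∈ Finset.Icc 1 (n - 1), betaC n u (v u) +
        ∑ u ∈ Finset.Icc 1 (n - 2),
          (∏ i ∈ Finset.Icc (u + 1) (n - 1), betaC n i (v i)) * gammaC n b u (v u) +
        gammaC n b (n - 1) (v (n - 1))) +
    b (v n) * (v n : ℝ)

/-- The denominator `D` in the definition of `ρ*`. -/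
noncomputable def Dval (n : ℕ) (b : ℕ → ℝ) (v : ℕ → ℕ) : ℝ :=
  ((n : ℝ) - (v n : ℝ)) *
      (∑ u ∈ Finset.Icc 1 (n - 2),
          (∏ i ∈ Finset.Icc (u + 1) (n - 1), betaC n i (v i)) * deltaC n b u (v u) +
        deltaC n b (n - 1) (v (n - 1))) +
    b n * (n : ℝ)

/-- Tuples `(v_1,…,v_n) ∈ {1,…,n}^{n−1} × {0,…,n}`, encoded as functions `ℕ → ℕ`. -/
def TupleSet (n : ℕ) : Set (ℕ → ℕ) :=
  {v | (∀ u, 1 ≤ u → u ≤ n - 1 → 1 ≤ v u ∧ v u ≤ n) ∧ v n ≤ n}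

/-- Closed form of the solution of a first-order linear recursion. -/
lemma linear_recursion_closed_form {F B G : ℕ → ℝ} (m : ℕ)
    (h : ∀ u, 1 ≤ u → u ≤ m → F (u + 1) = B u * F u + G u) :
    F (m + 1) = F 1 * ∏ u ∈ Finset.Icc 1 m, B u +
      ∑ u ∈ Finset.Icc 1 m, (∏ i ∈ Finset.Icc (u + 1) m, B i) * G u := by
  induction m with
  | zero => simp
  | succ m ih =>
    rw [h (m + 1) (by omega) le_rfl, ih fun u h1 h2 => h u h1 (by omega),
      Finset.prod_Icc_succ_top (by omega), Finset.sum_Icc_succ_top (by omega)]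
    have hs : ∑ u ∈ Finset.Icc 1 m, (∏ i ∈ Finset.Icc (u + 1) (m + 1), B i) * G u =
        B (m + 1) * ∑ u ∈ Finset.Icc 1 m, (∏ i ∈ Finset.Icc (u + 1) m, B i) * G u := by
      rw [Finset.mul_sum]
      refine Finset.sum_congr rfl fun u hu => ?_
      rw [Finset.prod_Icc_succ_top (by have := (Finset.mem_Icc.mp hu).2; omega)]
      ring
    rw [hs, Finset.Icc_eq_empty (a := m + 1 + 1) (b := m + 1) (by omega), Finset.prod_empty]
    ring

lemma betaC_nonneg (n u w : ℕ) : 0 ≤ betaC n u w := by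
  unfold betaC; positivity

lemma Dval_pos {n : ℕ} (hn : 2 ≤ n) {b : ℕ → ℝ} (hbpos : ∀ x, 1 ≤ x → x ≤ n → 0 < b x)
    {v : ℕ → ℕ} (hv : v n ≤ n) : 0 < Dval n b v := by
  have hd : ∀ u, 1 ≤ u → u ≤ n → 0 ≤ deltaC n b u (v u) := fun u h1 h2 => by
    have := (hbpos u h1 h2).le
    unfold deltaC; positivity
  have hv' : (0 : ℝ) ≤ n - v n := sub_nonneg.mpr (by exact_mod_cast hv)
  have hbn : 0 < b n * n := mul_pos (hbpos n (by omega) le_rfl) (by positivity)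
  refine add_pos_of_nonneg_of_pos (mul_nonneg hv' (add_nonneg ?_ ?_)) hbn
  · refine Finset.sum_nonneg fun u hu => ?_
    have := Finset.mem_Icc.mp hu
    exact mul_nonneg (Finset.prod_nonneg fun i _ => betaC_nonneg n i (v i))
      (hd u (by omega) (by omega))
  · exact hd _ (by omega) (by omega)

/-- Along a tuple realizing the recursion, the numerator and denominator combine to the
constraint of the linear program at `u = n`. -/
lemma Nval_sub_mul_Dval {n : ℕ} (hn : 2 ≤ n) {b f : ℕ → ℝ} {ρ : ℝ} {v : ℕ → ℕ}
    (hf1 : f 1 = b 1)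
    (h : ∀ u, 1 ≤ u → u ≤ n - 1 →
      f (u + 1) = betaC n u (v u) * f u + gammaC n b u (v u) - deltaC n b u (v u) * ρ) :
    Nval n b v - ρ * Dval n b v =
      ((n : ℝ) - v n) * f n + b (v n) * v n - ρ * (b n * n) := by
  obtain ⟨m, rfl⟩ : ∃ m, n = m + 2 := ⟨n - 2, by omega⟩
  have key := linear_recursion_closed_form (F := f) (B := fun u => betaC (m + 2) u (v u))
    (G := fun u => gammaC (m + 2) b u (v u) - deltaC (m + 2) b u (v u) * ρ) (m + 1)
    (fun u h1 h2 => by rw [h u h1 h2]; ring)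
  rw [Finset.sum_Icc_succ_top (by omega),
    Finset.Icc_eq_empty (a := m + 1 + 1) (b := m + 1) (by omega), Finset.prod_empty] at key
  simp only [mul_sub, Finset.sum_sub_distrib, ← mul_assoc, ← Finset.sum_mul] at key
  unfold Nval Dval
  simp only [show m + 2 - 1 = m + 1 by omega, show m + 2 - 2 = m by omega]
  rw [show f (m + 2) = f (m + 1 + 1) from rfl, key, hf1]
  ring

/-- Clearing the denominator `min{v, n−u}` in a bound by one term of the recursion. -/
lemma le_recursion_term_iff {n u w : ℕ} {b : ℕ → ℝ} {x y ρ : ℝ} (hu : u + 1 ≤ n) (hw : 1 ≤ w) :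
    y ≤ betaC n u w * x + gammaC n b u w - deltaC n b u w * ρ ↔
      y * (min w (n - u) : ℕ) ≤ (min u (n - w) : ℕ) * x + b w * w - b u * u * ρ := by
  have hm : (0 : ℝ) < (min w (n - u) : ℕ) := by
    exact_mod_cast (show 0 < min w (n - u) by omega)
  rw [← le_div_iff₀ hm]
  unfold betaC gammaC deltaC
  rw [show ((min u (n - w) : ℕ) * x + b w * w - b u * u * ρ) / ((min w (n - u) : ℕ) : ℝ) =
    ((min u (n - w) : ℕ) : ℝ) / (min w (n - u) : ℕ) * x + b w * w / (min w (n - u) : ℕ) -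
      b u * u / (min w (n - u) : ℕ) * ρ by ring]

/-- the pair `(f*, ρ*)` is feasible for the linear program. -/
theorem optimal_pair_feasible
    (n : ℕ) (hn : 2 ≤ n) (b : ℕ → ℝ)
    (hb0 : b 0 = 0)
    (hbpos : ∀ x, 1 ≤ x → x ≤ n → 0 < b x)
    (hbmono : ∀ x, 1 ≤ x → x + 1 ≤ n → b x < b (x + 1))
    (hbconv : ∀ x, 1 ≤ x → x + 2 ≤ n → b (x + 1) - b x ≤ b (x + 2) - b (x + 1))
    (ρstar : ℝ)
    (hρ : IsLeast {r : ℝ | ∃ v ∈ TupleSet n, r = Nval n b v / Dval n b v} ρstar)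
    (fstar : ℕ → ℝ)
    (hf0 : fstar 0 = 0) (hfn1 : fstar (n + 1) = 0)
    (hf1 : fstar 1 = b 1)
    (hfrec : ∀ u, 1 ≤ u → u + 1 ≤ n →
      fstar (u + 1) = (Finset.Icc 1 n).inf' (Finset.nonempty_Icc.mpr (by omega))
        (fun w => betaC n u w * fstar u + gammaC n b u w - deltaC n b u w * ρstar)) :
    ∀ u v : ℕ, u ≤ n → v ≤ n →
      (u + v ≤ n →
        b v * (v : ℝ) - ρstar * (b u * (u : ℝ)) + fstar u * (u : ℝ) -
          fstar (u + 1) * (v : ℝ) ≥ 0) ∧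
      (n < u + v →
        b v * (v : ℝ) - ρstar * (b u * (u : ℝ)) + fstar u * ((n : ℝ) - (v : ℝ)) -
          fstar (u + 1) * ((n : ℝ) - (u : ℝ)) ≥ 0) := by
  have hne : (Finset.Icc 1 n).Nonempty := Finset.nonempty_Icc.mpr (by omega)
  have hmono : ∀ x y, 1 ≤ x → x ≤ y → y ≤ n → b x ≤ b y := by
    intro x y hx hxy
    induction y, hxy using Nat.le_induction with
    | base => exact fun _ => le_rfl
    | succ y hxy ih => exact fun hy => (ih (by omega)).trans (hbmono y (by omega) hy).le
  have hpos1 : 0 < b 1 := hbpos 1 le_rfl (by omega)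
  have hDpos : ∀ v ∈ TupleSet n, 0 < Dval n b v := fun v hv => Dval_pos hn hbpos hv.2
  have hlast : ∀ k ≤ n, 0 ≤ ((n : ℝ) - k) * fstar n + b k * k - ρstar * (b n * n) := by
    intro k hk
    have hex : ∀ u, ∃ w, 1 ≤ u → u ≤ n - 1 → (1 ≤ w ∧ w ≤ n) ∧ fstar (u + 1) =
        betaC n u w * fstar u + gammaC n b u w - deltaC n b u w * ρstar := by
      intro u
      by_cases hu : 1 ≤ u ∧ u ≤ n - 1
      · obtain ⟨w, hw, he⟩ := Finset.exists_mem_eq_inf' hne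
          (fun w => betaC n u w * fstar u + gammaC n b u w - deltaC n b u w * ρstar)
        exact ⟨w, fun _ _ =>
          ⟨Finset.mem_Icc.mp hw, (hfrec u hu.1 (by omega)).trans he⟩⟩
      · exact ⟨0, fun h1 h2 => absurd ⟨h1, h2⟩ hu⟩
    choose w hw using hex
    set v := Function.update w n k
    have hvn : v n = k := Function.update_self ..
    have hvu : ∀ u, u ≤ n - 1 → v u = w u := fun u hu =>
      Function.update_of_ne (by omega) ..
    have hmem : v ∈ TupleSet n :=
      ⟨fun u h1 h2 => by rw [hvu u h2]; exact (hw u h1 h2).1, by rw [hvn]; exact hk⟩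
    have hle := hρ.2 ⟨v, hmem, rfl⟩
    rw [le_div_iff₀ (hDpos v hmem)] at hle
    have := Nval_sub_mul_Dval (ρ := ρstar) (v := v) hn hf1
      (fun u h1 h2 => by rw [hvu u h2]; exact (hw u h1 h2).2)
    rw [hvn] at this
    linarith
  have hρ1 : ρstar ≤ 1 := by
    have hmem : (fun _ => n : ℕ → ℕ) ∈ TupleSet n :=
      ⟨fun _ _ _ => ⟨(by omega : 1 ≤ n), le_rfl⟩, le_rfl⟩
    refine (hρ.2 ⟨_, hmem, rfl⟩).trans ?_
    rw [div_le_one (hDpos _ hmem)]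
    simp [Nval, Dval]
  have hstep : ∀ u w, 1 ≤ u → u + 1 ≤ n → 1 ≤ w → w ≤ n →
      fstar (u + 1) * (min w (n - u) : ℕ) ≤
        (min u (n - w) : ℕ) * fstar u + b w * w - b u * u * ρstar := by
    intro u w h1 h2 h3 h4
    rw [← le_recursion_term_iff h2 h3, hfrec u h1 h2]
    exact Finset.inf'_le (fun w => betaC n u w * fstar u + gammaC n b u w -
      deltaC n b u w * ρstar) (Finset.mem_Icc.mpr ⟨h3, h4⟩)
  have hsmall : ∀ u, 1 ≤ u → u ≤ n → ρstar * b u < b 1 → ρstar * b u ≤ fstar u := by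
    intro u hu
    induction u, hu using Nat.le_induction with
    | base => intro _ _; rw [hf1]; nlinarith
    | succ u hu ih =>
      intro hun hlt
      have hlt' : ρstar * b u < b 1 := by
        rcases le_total ρstar 0 with h | h
        · have := mul_nonneg (neg_nonneg.mpr h) (hbpos u hu (by omega)).le
          linarith
        · exact (mul_le_mul_of_nonneg_left (hbmono u hu hun).le h).trans_lt hlt
      have hfu := ih (by omega) hlt'
      rw [hfrec u hu hun, Finset.le_inf'_iff]
      intro w hw
      obtain ⟨hw1, hwn⟩ := Finset.mem_Icc.mp hw
      rw [le_recursion_term_iff hun hw1]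
      obtain ⟨c, hc⟩ : ∃ c, u = min u (n - w) + c := ⟨u - min u (n - w), by omega⟩
      have hcw : w = min w (n - u) + c := by omega
      have hcR : (u : ℝ) = (min u (n - w) : ℕ) + c := by exact_mod_cast hc
      have hcwR : (w : ℝ) = (min w (n - u) : ℕ) + c := by exact_mod_cast hcw
      have hbw := hmono 1 w le_rfl hw1 hwn
      have e1 := mul_le_mul_of_nonneg_right hfu (Nat.cast_nonneg (α := ℝ) (min u (n - w)))
      have e2 := mul_le_mul_of_nonneg_right hbw (Nat.cast_nonneg (α := ℝ) w)
      have e3 := mul_le_mul_of_nonneg_right hlt.le (Nat.cast_nonneg (α := ℝ) (min w (n - u)))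
      have e4 := mul_le_mul_of_nonneg_right hlt'.le (Nat.cast_nonneg (α := ℝ) c)
      generalize ((min u (n - w) : ℕ) : ℝ) = k at *
      generalize ((min w (n - u) : ℕ) : ℝ) = m at *
      rw [hcwR] at e2 ⊢
      rw [hcR]
      linarith
  have hlower : ∀ u, 1 ≤ u → u ≤ n → ρstar * b u ≤ fstar u := by
    intro u hu hun
    induction hun using Nat.decreasingInduction with
    | self =>
      have hn0 : (0 : ℝ) < n := by positivity
      have := hlast 0 (Nat.zero_le n)
      simp only [hb0, Nat.cast_zero] at this
      nlinarith
    | of_succ u hun ih =>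
      have ih := ih (by omega)
      by_contra! hlt
      have hb1 : b 1 ≤ ρstar * b u := by
        by_contra! h
        exact absurd (hsmall u hu hun.le h) (not_le.mpr hlt)
      have hρpos : 0 < ρstar :=
        pos_of_mul_pos_left (hpos1.trans_le hb1) (hbpos u hu hun.le).le
      have h1 := hstep u 1 hu hun le_rfl (by omega)
      rw [show min 1 (n - u) = 1 by omega, show min u (n - 1) = u by omega] at h1
      have h2 := mul_lt_mul_of_pos_left (hbmono u hu hun) hρpos
      have h3 := mul_pos (sub_pos.mpr hlt) (Nat.cast_pos (α := ℝ).mpr hu)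
      push_cast at h1
      linarith
  intro u v hu hv
  rcases Nat.eq_zero_or_pos u with rfl | hu0
  · refine ⟨fun _ => ?_, fun h => by omega⟩
    rcases Nat.eq_zero_or_pos v with rfl | hv0
    · simp
    · have := mul_nonneg (sub_nonneg.mpr (hmono 1 v le_rfl hv0 hv)) (Nat.cast_nonneg (α := ℝ) v)
      simp only [hb0, hf0, hf1, zero_add]
      linarith
  rcases Nat.eq_zero_or_pos v with rfl | hv0
  · refine ⟨fun _ => ?_, fun h => by omega⟩
    have := mul_nonneg (sub_nonneg.mpr (hlower u hu0 hu)) (Nat.cast_nonneg (α := ℝ) u)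
    simp only [Nat.cast_zero]
    linarith
  rcases hu.eq_or_lt with rfl | hun
  · refine ⟨fun h => by omega, fun _ => ?_⟩
    have := hlast v hv
    rw [hfn1]
    linarith
  have h := hstep u v hu0 hun hv0 hv
  constructor
  · intro huv
    rw [show min v (n - u) = v by omega, show min u (n - v) = u by omega] at h
    linarith
  · intro huv
    rw [show min v (n - u) = n - u by omega, show min u (n - v) = n - v by omega,
      Nat.cast_sub hu, Nat.cast_sub hv] at h
    linarith
end

section
/- Let n ≥ 2 be an integer and let h:[0,∞)→ℝ be nonnegative, continuously differentiable, strictly increasing, and strictly convex. Then for every real v with 0 < v ≤ n−1 it holds that h′(v)·[ (n−v)·(h(n−1)−h(n)) + h(n) ] < (h(n)−h(n−1))·h(v). -/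
/-- for `h` nonnegative, continuously differentiable, strictly increasing
and strictly convex on `[0,∞)` (with derivative `h'`), and every real `0 < v ≤ n−1`,
`h'(v)·[(n−v)(h(n−1)−h(n)) + h(n)] < (h(n)−h(n−1))·h(v)`. -/
theorem final_strict_inequality
    (n : ℕ) (hn : 2 ≤ n) (h h' : ℝ → ℝ)
    (h_nonneg : ∀ x ∈ Set.Ici (0 : ℝ), 0 ≤ h x)
    (h_cont : ContinuousOn h (Set.Ici (0 : ℝ)))
    (h_deriv : ∀ x ∈ Set.Ioi (0 : ℝ), HasDerivAt h (h' x) x)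
    (h_deriv_cont : ContinuousOn h' (Set.Ici (0 : ℝ)))
    (h_mono : StrictMonoOn h (Set.Ici (0 : ℝ)))
    (h_conv : StrictConvexOn ℝ (Set.Ici (0 : ℝ)) h) :
    ∀ v : ℝ, 0 < v → v ≤ (n : ℝ) - 1 →
      h' v * (((n : ℝ) - v) * (h ((n : ℝ) - 1) - h (n : ℝ)) + h (n : ℝ)) <
        (h (n : ℝ) - h ((n : ℝ) - 1)) * h v := by
  intro v hv hvn
  have hn' : (2 : ℝ) ≤ n := by exact_mod_cast hn
  have hv0 : v ∈ Set.Ici (0 : ℝ) := hv.le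
  have h00 : (0 : ℝ) ∈ Set.Ici (0 : ℝ) := Set.self_mem_Ici
  have hnmem : (n : ℝ) ∈ Set.Ici (0 : ℝ) := Set.mem_Ici.2 (by linarith)
  have hn1mem : (n : ℝ) - 1 ∈ Set.Ici (0 : ℝ) := Set.mem_Ici.2 (by linarith)
  have hvpos : 0 < h v := (h_nonneg 0 h00).trans_lt (h_mono h00 hv0 hv)
  have hder_pos : 0 < h' v := by
    have hslope := h_conv.slope_lt_of_hasDerivAt h00 hv0 hv (h_deriv v hv)
    rw [slope_def_field] at hslope
    exact (div_pos (sub_pos.2 (h_mono h00 hv0 hv)) (sub_pos.2 hv)).trans hslope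
  have hder_lt : h' v < (h n - h v) / (n - v) := by
    have hslope := h_conv.lt_slope_of_hasDerivAt hv0 hnmem (by linarith) (h_deriv v hv)
    rwa [slope_def_field] at hslope
  have hsecant : (h n - h v) / (n - v) ≤ h n - h ((n : ℝ) - 1) := by
    have hmono := h_conv.convexOn.secant_mono hnmem hv0 hn1mem (by linarith) (by linarith) hvn
    rw [← neg_div_neg_eq, neg_sub, neg_sub] at hmono
    rwa [sub_sub_cancel_left, div_neg, div_one, neg_sub] at hmono
  have hchord : (n - v) * (h ((n : ℝ) - 1) - h n) + h n ≤ h v := by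
    rw [div_le_iff₀ (by linarith)] at hsecant
    linarith
  calc _ ≤ h' v * h v := mul_le_mul_of_nonneg_left hchord hder_pos.le
    _ < _ := mul_lt_mul_of_pos_right (hder_lt.trans_le hsecant) hvpos
end

section
/- Let n ≥ 1 be an integer and let b:{1,…,n}→ℝ be positive and nondecreasing. Then the maximum value of ρ ∈ ℝ such that b(v)·v − ρ·b(u)·u + b(1)·(u−v) ≥ 0 holds for all u,v∈{0,…,n} (with the convention b(0)·0 = 0) equals b(1)/b(n); the binding constraint is (u,v)=(n,0). -/
/-- A sequence that is nondecreasing from each step to the next on `{1,…,n}` is monotone there. -/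
theorem le_of_le_succ_of_le {n : ℕ} {b : ℕ → ℝ}
    (hb : ∀ x, 1 ≤ x → x + 1 ≤ n → b x ≤ b (x + 1)) {x y : ℕ}
    (hx : 1 ≤ x) (hxy : x ≤ y) (hy : y ≤ n) : b x ≤ b y := by
  induction y, hxy using Nat.le_induction with
  | base => exact le_rfl
  | succ y hxy ih => exact (ih (by omega)).trans (hb y (by omega) hy)

/-- for `b` positive and nondecreasing on `{1,…,n}`, the greatest `ρ` such
that `b(v)·v − ρ·b(u)·u + b(1)·(u−v) ≥ 0` for all `u,v ∈ {0,…,n}` (convention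
`b(0)·0 = 0`) is `b(1)/b(n)`. -/
theorem congestion_independent_nu_zero_value
    (n : ℕ) (hn : 1 ≤ n) (b : ℕ → ℝ)
    (hb_pos : ∀ x, 1 ≤ x → x ≤ n → 0 < b x)
    (hb_mono : ∀ x, 1 ≤ x → x + 1 ≤ n → b x ≤ b (x + 1)) :
    IsGreatest {ρ : ℝ | ∀ u v : ℕ, u ≤ n → v ≤ n →
        b v * (v : ℝ) - ρ * (b u * (u : ℝ)) + b 1 * ((u : ℝ) - (v : ℝ)) ≥ 0}
      (b 1 / b n) := by
  have hb1 : 0 < b 1 := hb_pos 1 le_rfl hn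
  have hbn : 0 < b n := hb_pos n hn le_rfl
  have hn0 : (0 : ℝ) < n := by exact_mod_cast hn
  constructor
  · intro u v hu hv
    have h_v : 0 ≤ (b v - b 1) * (v : ℝ) := by
      rcases Nat.eq_zero_or_pos v with rfl | hv0
      · simp
      · exact mul_nonneg (sub_nonneg.2 (le_of_le_succ_of_le hb_mono le_rfl hv0 hv)) v.cast_nonneg
    have h_u : 0 ≤ (b 1 - b 1 / b n * b u) * (u : ℝ) := by
      rcases Nat.eq_zero_or_pos u with rfl | hu0
      · simp
      · refine mul_nonneg (sub_nonneg.2 ?_) u.cast_nonneg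
        rw [div_mul_eq_mul_div, div_le_iff₀ hbn]
        exact mul_le_mul_of_nonneg_left (le_of_le_succ_of_le hb_mono hu0 hu le_rfl) hb1.le
    linarith
  · intro ρ hρ
    have h := hρ n 0 le_rfl n.zero_le
    rw [le_div_iff₀ hbn]
    refine le_of_mul_le_mul_right ?_ hn0
    push_cast at h
    linarith
end
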